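/- arXiv:2103.02479 — 6 statements merged into one kernel-verified Lean document; each statement's English description precedes it below -/
import Mathlib

section
/- (Theorem 1, minimax multiple-model estimation.) Let K ≥ 1, and for each model i ∈ {1,…,K} let F_i ∈ ℝ^{n×n}, H_i ∈ ℝ^{m×n}. Let Q, P₀ ∈ ℝ^{n×n} and R ∈ ℝ^{m×m} be symmetric positive definite, let γ > 0, let x̂₀ ∈ ℝⁿ and let measurements y₀,…,y_{N−1} ∈ ℝ^m be given. For each i define P_{t,i}, x̆_{t,i}, K_{t,i}, c_{t,i} by the Kalman recursions (see context). If H_i P_{N,i} H_iᵀ ≺ γ² I for every i, then the game value J = inf_{ŷ ∈ ℝ^m} sup over i ∈ {1,…,K} and state trajectories x : {0,…,N} → ℝⁿ of [ |ŷ − H_i x_N|² − γ² ( |x₀ − x̂₀|²_{P₀⁻¹} + Σ_{t=0}^{N−1} ( |x_{t+1} − F_i x_t|²_{Q⁻¹} + |y_t − H_i x_t|²_{R⁻¹} ) ) ] satisfies J = inf_{ŷ ∈ ℝ^m} max_{i ∈ {1,…,K}} [ |ŷ − H_i x̆_{N,i}|²_{(I − γ⁻² H_i P_{N,i} H_iᵀ)⁻¹}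 − γ² c_{N,i} ]. -/
open Matrix

/-- Weighted squared norm `|z|²_M = zᵀ M z`. -/
noncomputable def qf {k : ℕ} (M : Matrix (Fin k) (Fin k) ℝ) (z : Fin k → ℝ) : ℝ :=
  z ⬝ᵥ M *ᵥ z

lemma qf_neg {k : ℕ} (M : Matrix (Fin k) (Fin k) ℝ) (z : Fin k → ℝ) : qf M (-z) = qf M z := by
  simp [qf, mulVec_neg]

lemma qf_smul {k : ℕ} (r : ℝ) (M : Matrix (Fin k) (Fin k) ℝ) (z : Fin k → ℝ) :
    qf (r • M) z = r * qf M z := by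
  simp [qf, smul_mulVec]

lemma qf_add_matrix {k : ℕ} (A B : Matrix (Fin k) (Fin k) ℝ) (z : Fin k → ℝ) :
    qf (A + B) z = qf A z + qf B z := by
  simp [qf, add_mulVec]

lemma qf_sub_matrix {k : ℕ} (A B : Matrix (Fin k) (Fin k) ℝ) (z : Fin k → ℝ) :
    qf (A - B) z = qf A z - qf B z := by
  simp [qf, sub_mulVec]

lemma qf_sub {k : ℕ} {M : Matrix (Fin k) (Fin k) ℝ} (hM : M.IsSymm) (u v : Fin k → ℝ) :
    qf M (u - v) = qf M u - 2 * (u ⬝ᵥ M *ᵥ v) + qf M v := by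
  have h : v ⬝ᵥ M *ᵥ u = u ⬝ᵥ M *ᵥ v := by
    rw [dotProduct_mulVec, ← mulVec_transpose, hM.eq, dotProduct_comm]
  simp only [qf, mulVec_sub, sub_dotProduct, dotProduct_sub, h]
  ring

lemma qf_mulVec {k l : ℕ} (M : Matrix (Fin k) (Fin k) ℝ) (A : Matrix (Fin k) (Fin l) ℝ)
    (v : Fin l → ℝ) : qf M (A *ᵥ v) = qf (Aᵀ * M * A) v := by
  simp only [qf, ← mulVec_mulVec]
  rw [dotProduct_mulVec v Aᵀ, vecMul_transpose]

lemma qf_nonneg {k : ℕ} {M : Matrix (Fin k) (Fin k) ℝ} (hM : M.PosDef) (z : Fin k → ℝ) :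
    0 ≤ qf M z := by
  simpa [qf] using hM.posSemidef.dotProduct_mulVec_nonneg z

/-- The posterior covariance of a linear observation, in inverse (information) form. -/
lemma information_mul_posterior {n m : ℕ} {P : Matrix (Fin n) (Fin n) ℝ}
    {R : Matrix (Fin m) (Fin m) ℝ} (H : Matrix (Fin m) (Fin n) ℝ)
    (hP : IsUnit P.det) (hR : IsUnit R.det) (hS : IsUnit (R + H * P * Hᵀ).det) :
    (P⁻¹ + Hᵀ * R⁻¹ * H) * (P * Hᵀ * (R + H * P * Hᵀ)⁻¹) = Hᵀ * R⁻¹ ∧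
    (P⁻¹ + Hᵀ * R⁻¹ * H) * (P - P * Hᵀ * (R + H * P * Hᵀ)⁻¹ * (H * P)) = 1 := by
  have hgain : (P⁻¹ + Hᵀ * R⁻¹ * H) * (P * Hᵀ * (R + H * P * Hᵀ)⁻¹) = Hᵀ * R⁻¹ := by
    calc _ = (P⁻¹ * P * Hᵀ + Hᵀ * R⁻¹ * (H * P * Hᵀ)) * (R + H * P * Hᵀ)⁻¹ := by
          simp only [Matrix.mul_assoc, Matrix.add_mul]
      _ = Hᵀ * R⁻¹ * ((R + H * P * Hᵀ) * (R + H * P * Hᵀ)⁻¹) := by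
          rw [nonsing_inv_mul _ hP, Matrix.one_mul, ← Matrix.mul_assoc _ (R + H * P * Hᵀ),
            Matrix.mul_add _ R, nonsing_inv_mul_cancel_right _ _ hR]
      _ = _ := by rw [mul_nonsing_inv _ hS, Matrix.mul_one]
  refine ⟨hgain, ?_⟩
  rw [Matrix.mul_sub, ← Matrix.mul_assoc _ _ (H * P), hgain, Matrix.add_mul,
    nonsing_inv_mul _ hP]
  simp only [Matrix.mul_assoc, add_sub_cancel_right]

/-- Completing the square in the sum of a prior term and an observation term. -/
lemma qf_add_qf_eq {n m : ℕ} {P : Matrix (Fin n) (Fin n) ℝ} {R : Matrix (Fin m) (Fin m) ℝ}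
    (H : Matrix (Fin m) (Fin n) ℝ) (hPs : P.IsSymm) (hRs : R.IsSymm)
    (hP : IsUnit P.det) (hR : IsUnit R.det) (hS : IsUnit (R + H * P * Hᵀ).det)
    (a x : Fin n → ℝ) (y : Fin m → ℝ) :
    qf P⁻¹ (x - a) + qf R⁻¹ (y - H *ᵥ x) =
      qf (R + H * P * Hᵀ)⁻¹ (y - H *ᵥ a) +
        qf (P - P * Hᵀ * (R + H * P * Hᵀ)⁻¹ * (H * P))⁻¹
          (x - (a + (P * Hᵀ * (R + H * P * Hᵀ)⁻¹) *ᵥ (y - H *ᵥ a))) := by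
  obtain ⟨hgain, hinv⟩ := information_mul_posterior H hP hR hS
  rw [inv_eq_left_inv hinv]
  set S := R + H * P * Hᵀ with hSdef
  set L := P⁻¹ + Hᵀ * R⁻¹ * H with hL
  set e := x - a with he
  set r := y - H *ᵥ a with hr
  have hRi : R⁻¹.IsSymm := by rw [IsSymm, transpose_nonsing_inv, hRs.eq]
  have hPi : P⁻¹.IsSymm := by rw [IsSymm, transpose_nonsing_inv, hPs.eq]
  have hSs : S.IsSymm := by
    simp [IsSymm, hSdef, transpose_mul, hPs.eq, hRs.eq, Matrix.mul_assoc]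
  have hLs : L.IsSymm := by
    simp [IsSymm, hL, transpose_mul, hPi.eq, hRi.eq, Matrix.mul_assoc]
  have h1 : y - H *ᵥ x = r - H *ᵥ e := by
    rw [hr, he, mulVec_sub]; abel
  have h2 : x - (a + (P * Hᵀ * S⁻¹) *ᵥ r) = e - (P * Hᵀ * S⁻¹) *ᵥ r := by
    rw [he]; abel
  have h3 : (P * Hᵀ * S⁻¹)ᵀ * L * (P * Hᵀ * S⁻¹) = R⁻¹ - S⁻¹ := by
    have hSi : (S⁻¹)ᵀ = S⁻¹ := by rw [transpose_nonsing_inv, hSs.eq]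
    have hHPH : H * P * Hᵀ = S - R := by rw [hSdef]; abel
    rw [Matrix.mul_assoc, hgain, transpose_mul, transpose_mul, hSi, hPs.eq, transpose_transpose]
    calc _ = S⁻¹ * (H * P * Hᵀ) * R⁻¹ := by simp only [Matrix.mul_assoc]
      _ = _ := by
        rw [hHPH, Matrix.mul_sub, Matrix.sub_mul, nonsing_inv_mul _ hS, Matrix.one_mul,
          mul_nonsing_inv_cancel_right _ _ hR]
  have h4 : r ⬝ᵥ R⁻¹ *ᵥ (H *ᵥ e) = e ⬝ᵥ L *ᵥ ((P * Hᵀ * S⁻¹) *ᵥ r) := by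
    rw [mulVec_mulVec, mulVec_mulVec, hgain, dotProduct_mulVec, ← mulVec_transpose,
      dotProduct_comm, transpose_mul, hRi.eq]
  rw [h1, h2, qf_sub hRi, qf_sub hLs, qf_mulVec, qf_mulVec, h3, h4, hL, qf_add_matrix,
    qf_sub_matrix]
  ring

lemma Matrix.PosDef.isSymm_real {k : ℕ} {M : Matrix (Fin k) (Fin k) ℝ} (hM : M.PosDef) :
    M.IsSymm := by
  simpa [IsSymm, IsHermitian] using hM.isHermitian

lemma Matrix.PosDef.isUnit_det_real {k : ℕ} {M : Matrix (Fin k) (Fin k) ℝ} (hM : M.PosDef) :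
    IsUnit M.det := hM.det_pos.ne'.isUnit

lemma Matrix.PosDef.mul_mul_transpose_posSemidef {k l : ℕ} {M : Matrix (Fin k) (Fin k) ℝ}
    (hM : M.PosDef) (A : Matrix (Fin l) (Fin k) ℝ) : (A * M * Aᵀ).PosSemidef := by
  simpa using hM.posSemidef.mul_mul_conjTranspose_same A

lemma posterior_posDef {n m : ℕ} {P : Matrix (Fin n) (Fin n) ℝ} {R : Matrix (Fin m) (Fin m) ℝ}
    (H : Matrix (Fin m) (Fin n) ℝ) (hP : P.PosDef) (hR : R.PosDef) :
    (P - P * Hᵀ * (R + H * P * Hᵀ)⁻¹ * (H * P)).PosDef := by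
  have hinv := (information_mul_posterior H hP.isUnit_det_real hR.isUnit_det_real
    (hR.add_posSemidef (hP.mul_mul_transpose_posSemidef H)).isUnit_det_real).2
  rw [← inv_eq_right_inv hinv]
  refine (hP.inv.add_posSemidef ?_).inv
  simpa using hR.inv.mul_mul_transpose_posSemidef Hᵀ

/-- One Kalman step: the arrival cost, as an identity with an explicit nonnegative remainder
that vanishes for a suitable previous state. -/
lemma kalman_step {n m : ℕ} {P Q : Matrix (Fin n) (Fin n) ℝ} {R : Matrix (Fin m) (Fin m) ℝ}
    (F : Matrix (Fin n) (Fin n) ℝ) (H : Matrix (Fin m) (Fin n) ℝ)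
    (hP : P.PosDef) (hQ : Q.PosDef) (hR : R.PosDef) (a : Fin n → ℝ) (y : Fin m → ℝ)
    {P' : Matrix (Fin n) (Fin n) ℝ} {a' : Fin n → ℝ}
    (hP' : P' = Q + F * P * Fᵀ - F * P * Hᵀ * (R + H * P * Hᵀ)⁻¹ * (H * P * Fᵀ))
    (ha' : a' = F *ᵥ a + (F * P * Hᵀ * (R + H * P * Hᵀ)⁻¹) *ᵥ (y - H *ᵥ a)) :
    P'.PosDef ∧
    (∀ x z, qf P'⁻¹ (z - a') + qf (R + H * P * Hᵀ)⁻¹ (H *ᵥ a - y) ≤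
      qf P⁻¹ (x - a) + (qf Q⁻¹ (z - F *ᵥ x) + qf R⁻¹ (y - H *ᵥ x))) ∧
    ∀ z, ∃ x, qf P⁻¹ (x - a) + (qf Q⁻¹ (z - F *ᵥ x) + qf R⁻¹ (y - H *ᵥ x)) =
      qf P'⁻¹ (z - a') + qf (R + H * P * Hᵀ)⁻¹ (H *ᵥ a - y) := by
  have hS := hR.add_posSemidef (hP.mul_mul_transpose_posSemidef H)
  have hM := posterior_posDef H hP hR
  have key := fun x ↦ qf_add_qf_eq H hP.isSymm_real hR.isSymm_real hP.isUnit_det_real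
    hR.isUnit_det_real hS.isUnit_det_real a x y
  set S := R + H * P * Hᵀ
  set M := P - P * Hᵀ * S⁻¹ * (H * P)
  set b := a + (P * Hᵀ * S⁻¹) *ᵥ (y - H *ᵥ a)
  have hPM : P' = Q + F * M * Fᵀ := by
    simp only [hP', M, Matrix.mul_sub, Matrix.sub_mul, Matrix.mul_assoc, add_sub_assoc]
  have hab : a' = F *ᵥ b := by
    simp only [ha', b, mulVec_add, mulVec_mulVec, Matrix.mul_assoc]
  have hP'd : P'.PosDef := hPM ▸ hQ.add_posSemidef (hM.mul_mul_transpose_posSemidef F)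
  have key2 := fun x z ↦ qf_add_qf_eq F hM.isSymm_real hQ.isSymm_real hM.isUnit_det_real
    hQ.isUnit_det_real (hPM ▸ hP'd.isUnit_det_real) b x z
  have hrem := posterior_posDef F hM hQ
  rw [← hPM, ← hab] at key2
  rw [← hPM] at hrem
  have hneg : qf S⁻¹ (H *ᵥ a - y) = qf S⁻¹ (y - H *ᵥ a) := by
    rw [← qf_neg, neg_sub]
  refine ⟨hP'd, fun x z ↦ ?_, fun z ↦ ⟨b + (M * Fᵀ * P'⁻¹) *ᵥ (z - a'), ?_⟩⟩
  · have h0 := qf_nonneg hrem.inv (x - (b + (M * Fᵀ * P'⁻¹) *ᵥ (z - a')))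
    linarith [key x, key2 x z]
  · have h1 := key (b + (M * Fᵀ * P'⁻¹) *ᵥ (z - a'))
    have h2 := key2 (b + (M * Fᵀ * P'⁻¹) *ᵥ (z - a')) z
    rw [sub_self, show qf _ (0 : Fin n → ℝ) = 0 by simp [qf]] at h2
    linarith

/-- The Kalman recursion computes the minimal cost of reaching a given state at time `t`. -/
lemma kalman_arrival_cost {n m : ℕ} (F : Matrix (Fin n) (Fin n) ℝ) (H : Matrix (Fin m) (Fin n) ℝ)
    {Q P₀ : Matrix (Fin n) (Fin n) ℝ} {R : Matrix (Fin m) (Fin m) ℝ}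
    (hQ : Q.PosDef) (hP₀ : P₀.PosDef) (hR : R.PosDef)
    {xh₀ : Fin n → ℝ} {y : ℕ → Fin m → ℝ} {P : ℕ → Matrix (Fin n) (Fin n) ℝ}
    {xbr : ℕ → Fin n → ℝ} {c : ℕ → ℝ} (hP0 : P 0 = P₀)
    (hPrec : ∀ t, P (t + 1) =
      Q + F * P t * Fᵀ - F * P t * Hᵀ * (R + H * P t * Hᵀ)⁻¹ * (H * P t * Fᵀ))
    (hx0 : xbr 0 = xh₀)
    (hxrec : ∀ t, xbr (t + 1) =
      F *ᵥ xbr t + (F * P t * Hᵀ * (R + H * P t * Hᵀ)⁻¹) *ᵥ (y t - H *ᵥ xbr t))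
    (hc0 : c 0 = 0)
    (hcrec : ∀ t, c (t + 1) = c t + qf (R + H * P t * Hᵀ)⁻¹ (H *ᵥ xbr t - y t)) (t : ℕ) :
    (P t).PosDef ∧
    (∀ x : ℕ → Fin n → ℝ, qf (P t)⁻¹ (x t - xbr t) + c t ≤
      qf P₀⁻¹ (x 0 - xh₀) + ∑ s ∈ Finset.range t,
        (qf Q⁻¹ (x (s + 1) - F *ᵥ x s) + qf R⁻¹ (y s - H *ᵥ x s))) ∧
    ∀ z, ∃ x : ℕ → Fin n → ℝ, x t = z ∧
      qf P₀⁻¹ (x 0 - xh₀) + ∑ s ∈ Finset.range t,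
        (qf Q⁻¹ (x (s + 1) - F *ᵥ x s) + qf R⁻¹ (y s - H *ᵥ x s)) =
      qf (P t)⁻¹ (z - xbr t) + c t := by
  induction t with
  | zero =>
    subst hP0 hx0
    exact ⟨hP₀, fun x ↦ by simp [hc0], fun z ↦ ⟨fun _ ↦ z, rfl, by simp [hc0]⟩⟩
  | succ t ih =>
    obtain ⟨hPt, hle, hex⟩ := ih
    obtain ⟨hPt', hle', hex'⟩ :=
      kalman_step F H hPt hQ hR (xbr t) (y t) (hPrec t) (hxrec t)
    refine ⟨hPt', fun x ↦ ?_, fun z ↦ ?_⟩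
    · rw [Finset.sum_range_succ, hcrec]
      linarith [hle x, hle' (x t) (x (t + 1))]
    · obtain ⟨w, hw⟩ := hex' z
      obtain ⟨x, rfl, hx⟩ := hex w
      refine ⟨Function.update x (t + 1) z, Function.update_self .., ?_⟩
      have hupd : ∀ s ≤ t, Function.update x (t + 1) z s = x s := fun s hs ↦
        Function.update_of_ne (by omega) _ _
      have hsum : ∑ s ∈ Finset.range t, (qf Q⁻¹ (Function.update x (t + 1) z (s + 1) -
          F *ᵥ Function.update x (t + 1) z s) +
          qf R⁻¹ (y s - H *ᵥ Function.update x (t + 1) z s)) =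
          ∑ s ∈ Finset.range t,
            (qf Q⁻¹ (x (s + 1) - F *ᵥ x s) + qf R⁻¹ (y s - H *ᵥ x s)) := by
        refine Finset.sum_congr rfl fun s hs ↦ ?_
        have := Finset.mem_range.1 hs
        rw [hupd s (by omega), hupd (s + 1) (by omega)]
      rw [Finset.sum_range_succ, hsum, hupd 0 (by omega), hupd t le_rfl, Function.update_self,
        hcrec]
      linarith

/-- Maximizing over the terminal state. -/
lemma terminal_max {n m : ℕ} {P : Matrix (Fin n) (Fin n) ℝ} (H : Matrix (Fin m) (Fin n) ℝ)
    (hP : P.PosDef) {g : ℝ} (hg : 0 < g)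
    (hgam : (g • (1 : Matrix (Fin m) (Fin m) ℝ) - H * P * Hᵀ).PosDef)
    (a : Fin n → ℝ) (y : Fin m → ℝ) :
    (∀ z, (y - H *ᵥ z) ⬝ᵥ (y - H *ᵥ z) - g * qf P⁻¹ (z - a) ≤
      qf ((1 : Matrix (Fin m) (Fin m) ℝ) - g⁻¹ • (H * P * Hᵀ))⁻¹ (y - H *ᵥ a)) ∧
    ∃ z, (y - H *ᵥ z) ⬝ᵥ (y - H *ᵥ z) - g * qf P⁻¹ (z - a) =
      qf ((1 : Matrix (Fin m) (Fin m) ℝ) - g⁻¹ • (H * P * Hᵀ))⁻¹ (y - H *ᵥ a) := by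
  set T := g • (1 : Matrix (Fin m) (Fin m) ℝ) - H * P * Hᵀ with hT
  set R : Matrix (Fin m) (Fin m) ℝ := -(g • 1) with hRdef
  have hTu := hgam.isUnit_det_real
  have hRmul : R * -(g⁻¹ • (1 : Matrix (Fin m) (Fin m) ℝ)) = 1 := by
    simp [hRdef, smul_smul, hg.ne']
  have hRinv : R⁻¹ = -(g⁻¹ • (1 : Matrix (Fin m) (Fin m) ℝ)) := inv_eq_right_inv hRmul
  have hRu : IsUnit R.det := isUnit_det_of_right_inverse hRmul
  have hRs : R.IsSymm := by simp [IsSymm, hRdef]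
  have hST : R + H * P * Hᵀ = -T := by rw [hRdef, hT]; abel
  have hSmul : (-T) * (-T⁻¹) = 1 := by simp [mul_nonsing_inv _ hTu]
  have hSinv : (-T)⁻¹ = -T⁻¹ := inv_eq_right_inv hSmul
  have hSu : IsUnit (R + H * P * Hᵀ).det := hST ▸ isUnit_det_of_right_inverse hSmul
  have hW : ((1 : Matrix (Fin m) (Fin m) ℝ) - g⁻¹ • (H * P * Hᵀ))⁻¹ = g • T⁻¹ := by
    refine inv_eq_right_inv ?_
    have : (1 : Matrix (Fin m) (Fin m) ℝ) - g⁻¹ • (H * P * Hᵀ) = g⁻¹ • T := by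
      rw [hT, smul_sub, smul_smul, inv_mul_cancel₀ hg.ne', one_smul]
    rw [this, smul_mul_smul_comm, mul_nonsing_inv _ hTu, inv_mul_cancel₀ hg.ne', one_smul]
  have key := fun z ↦ qf_add_qf_eq H hP.isSymm_real hRs hP.isUnit_det_real hRu hSu a z y
  rw [hST, hSinv, hRinv] at key
  have hM : (P - P * Hᵀ * (-T⁻¹) * (H * P)).PosDef := by
    have h := hgam.inv.mul_mul_transpose_posSemidef (P * Hᵀ)
    rw [transpose_mul, transpose_transpose, hP.isSymm_real.eq] at h
    simpa using hP.add_posSemidef h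
  set M := P - P * Hᵀ * (-T⁻¹) * (H * P)
  set v := a + (P * Hᵀ * -T⁻¹) *ᵥ (y - H *ᵥ a)
  have hqf : ∀ u : Fin m → ℝ, qf (-(g⁻¹ • (1 : Matrix (Fin m) (Fin m) ℝ))) u =
      -(g⁻¹ * (u ⬝ᵥ u)) := fun u ↦ by
    simp [qf, neg_mulVec, smul_mulVec]
  have hqT : ∀ u : Fin m → ℝ, qf (-T⁻¹) u = -qf T⁻¹ u := fun u ↦ by
    simp [qf, neg_mulVec]
  have main : ∀ z, (y - H *ᵥ z) ⬝ᵥ (y - H *ᵥ z) - g * qf P⁻¹ (z - a) =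
      g * qf T⁻¹ (y - H *ᵥ a) - g * qf M⁻¹ (z - v) := fun z ↦ by
    have h := key z
    rw [hqf, hqT] at h
    have h' := congrArg (g * ·) h
    simp only [mul_add, mul_neg, mul_inv_cancel_left₀ hg.ne'] at h'
    linarith
  simp only [hW, qf_smul, main]
  refine ⟨fun z ↦ ?_, v, by simp [qf]⟩
  linarith [mul_nonneg hg.le (qf_nonneg hM.inv (z - v))]

/-- Supremum over a product, when the supremum over the second factor is attained. -/
lemma ciSup_prod_eq_of_attained {ι X : Type*} [Finite ι] [Nonempty ι] (f : ι × X → ℝ) (V : ι → ℝ)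
    (hle : ∀ i x, f (i, x) ≤ V i) (hex : ∀ i, ∃ x, f (i, x) = V i) :
    ⨆ p, f p = ⨆ i, V i := by
  have hV : BddAbove (Set.range V) := (Set.finite_range V).bddAbove
  have hb : ∀ p, f p ≤ ⨆ i, V i := fun p ↦ (hle p.1 p.2).trans (le_ciSup hV p.1)
  have : Nonempty X := (hex (Classical.arbitrary ι)).nonempty
  refine le_antisymm (ciSup_le hb) (ciSup_le fun i ↦ ?_)
  obtain ⟨x, hx⟩ := hex i
  exact hx ▸ le_ciSup ⟨_, Set.forall_mem_range.2 hb⟩ (i, x)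

/-- (Theorem 1, minimax multiple-model estimation.) If `H_i P_{N,i} H_iᵀ ≺ γ² I` for
every model `i`, then the game value
`inf_ŷ sup_{i, x(·)} [ |ŷ − H_i x_N|² − γ² ( |x₀ − x̂₀|²_{P₀⁻¹}
  + Σ_t (|x_{t+1} − F_i x_t|²_{Q⁻¹} + |y_t − H_i x_t|²_{R⁻¹}) ) ]`
equals
`inf_ŷ max_i [ |ŷ − H_i x̆_{N,i}|²_{(I − γ⁻² H_i P_{N,i} H_iᵀ)⁻¹} − γ² c_{N,i} ]`. -/
theorem minimax_multiple_model_estimation {n m N K : ℕ} (hK : 1 ≤ K)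
    (F : Fin K → Matrix (Fin n) (Fin n) ℝ) (H : Fin K → Matrix (Fin m) (Fin n) ℝ)
    (Q P₀ : Matrix (Fin n) (Fin n) ℝ) (R : Matrix (Fin m) (Fin m) ℝ)
    (hQ : Q.PosDef) (hP₀ : P₀.PosDef) (hR : R.PosDef)
    (γ : ℝ) (hγ : 0 < γ)
    (xh₀ : Fin n → ℝ) (y : ℕ → Fin m → ℝ)
    (P : Fin K → ℕ → Matrix (Fin n) (Fin n) ℝ)
    (xbr : Fin K → ℕ → Fin n → ℝ) (c : Fin K → ℕ → ℝ)
    (hP0 : ∀ i, P i 0 = P₀)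
    (hPrec : ∀ i t, P i (t + 1) =
      Q + F i * P i t * (F i)ᵀ -
        F i * P i t * (H i)ᵀ * (R + H i * P i t * (H i)ᵀ)⁻¹ * (H i * P i t * (F i)ᵀ))
    (hx0 : ∀ i, xbr i 0 = xh₀)
    (hxrec : ∀ i t, xbr i (t + 1) =
      F i *ᵥ xbr i t +
        (F i * P i t * (H i)ᵀ * (R + H i * P i t * (H i)ᵀ)⁻¹) *ᵥ (y t - H i *ᵥ xbr i t))
    (hc0 : ∀ i, c i 0 = 0)
    (hcrec : ∀ i t, c i (t + 1) =
      c i t + qf (R + H i * P i t * (H i)ᵀ)⁻¹ (H i *ᵥ xbr i t - y t))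
    (hgam : ∀ i, (γ ^ 2 • (1 : Matrix (Fin m) (Fin m) ℝ) - H i * P i N * (H i)ᵀ).PosDef) :
    (⨅ yh : Fin m → ℝ, ⨆ p : Fin K × (ℕ → Fin n → ℝ),
        (yh - H p.1 *ᵥ p.2 N) ⬝ᵥ (yh - H p.1 *ᵥ p.2 N) -
          γ ^ 2 * (qf P₀⁻¹ (p.2 0 - xh₀) +
            ∑ t ∈ Finset.range N,
              (qf Q⁻¹ (p.2 (t + 1) - F p.1 *ᵥ p.2 t) + qf R⁻¹ (y t - H p.1 *ᵥ p.2 t)))) =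
      ⨅ yh : Fin m → ℝ, ⨆ i : Fin K,
        (qf ((1 : Matrix (Fin m) (Fin m) ℝ) - (γ ^ 2)⁻¹ • (H i * P i N * (H i)ᵀ))⁻¹
            (yh - H i *ᵥ xbr i N) -
          γ ^ 2 * c i N) := by
  have : Nonempty (Fin K) := ⟨⟨0, hK⟩⟩
  have harr := fun i ↦ kalman_arrival_cost (F i) (H i) hQ hP₀ hR (hP0 i) (hPrec i) (hx0 i)
    (hxrec i) (hc0 i) (hcrec i) N
  have hg : 0 < γ ^ 2 := by positivity
  have hterm := fun i yh ↦ terminal_max (H i) (harr i).1 hg (hgam i) (xbr i N) yh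
  refine iInf_congr fun yh ↦ ciSup_prod_eq_of_attained _ _ (fun i x ↦ ?_) fun i ↦ ?_
  · have h := mul_le_mul_of_nonneg_left ((harr i).2.1 x) hg.le
    rw [mul_add] at h
    linarith [(hterm i yh).1 (x N)]
  · obtain ⟨z, hz⟩ := (hterm i yh).2
    obtain ⟨x, rfl, hx⟩ := (harr i).2.2 z
    refine ⟨x, ?_⟩
    dsimp only
    rw [hx, mul_add]
    linarith
end

section
/- (Terminal-state maximization; footnote of Theorem 1.) Let H ∈ ℝ^{m×n}, let P ∈ ℝ^{n×n} be symmetric positive definite, let γ > 0 with H P Hᵀ ≺ γ² I, let ŷ ∈ ℝ^m, x̆ ∈ ℝⁿ and c ∈ ℝ. Then the function x ↦ |ŷ − H x|² − γ² ( |x − x̆|²_{P⁻¹} + c ) attains its maximum over x ∈ ℝⁿ at x* = (Hᵀ H − γ² P⁻¹)⁻¹ ( Hᵀ ŷ − γ² P⁻¹ x̆ ), and the maximum value equals |ŷ − H x̆|²_{(I − γ⁻² H P Hᵀ)⁻¹} − γ² c. -/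
open Matrix

theorem dotProduct_transpose_mulVec_eq {m n : ℕ} (H : Matrix (Fin m) (Fin n) ℝ)
    (x : Fin n → ℝ) (u : Fin m → ℝ) : x ⬝ᵥ Hᵀ *ᵥ u = H *ᵥ x ⬝ᵥ u := by
  rw [dotProduct_mulVec, vecMul_transpose]

theorem Matrix.PosDef.dotProduct_mulVec_comm {n : ℕ} {Q : Matrix (Fin n) (Fin n) ℝ}
    (hQ : Q.PosDef) (x y : Fin n → ℝ) : x ⬝ᵥ Q *ᵥ y = y ⬝ᵥ Q *ᵥ x := by
  have h : Qᵀ = Q := by simpa using hQ.1.eq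
  calc x ⬝ᵥ Q *ᵥ y = x ⬝ᵥ Qᵀ *ᵥ y := by rw [h]
    _ = y ⬝ᵥ Q *ᵥ x := by rw [dotProduct_transpose_mulVec_eq, dotProduct_comm]

theorem Matrix.PosDef.qf_add {n : ℕ} {Q : Matrix (Fin n) (Fin n) ℝ}
    (hQ : Q.PosDef) (x y : Fin n → ℝ) :
    qf Q (x + y) = qf Q x + 2 * (y ⬝ᵥ Q *ᵥ x) + qf Q y := by
  simp only [qf, mulVec_add, add_dotProduct, dotProduct_add, hQ.dotProduct_mulVec_comm x y]
  ring

theorem Matrix.PosDef.qf_pos {n : ℕ} {Q : Matrix (Fin n) (Fin n) ℝ}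
    (hQ : Q.PosDef) {x : Fin n → ℝ} (hx : x ≠ 0) : 0 < qf Q x := by
  simpa [qf] using hQ.dotProduct_mulVec_pos hx

theorem Matrix.PosDef.qf_nonneg {n : ℕ} {Q : Matrix (Fin n) (Fin n) ℝ}
    (hQ : Q.PosDef) (x : Fin n → ℝ) : 0 ≤ qf Q x := by
  simpa [qf] using hQ.posSemidef.dotProduct_mulVec_nonneg x

theorem Matrix.PosDef.inv_mulVec_mulVec {n : ℕ} {P : Matrix (Fin n) (Fin n) ℝ}
    (hP : P.PosDef) (x : Fin n → ℝ) : P⁻¹ *ᵥ (P *ᵥ x) = x := by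
  rw [mulVec_mulVec, nonsing_inv_mul _ ((isUnit_iff_isUnit_det _).1 hP.isUnit), one_mulVec]

/-- The bound `H P Hᵀ ≺ g I` dualizes to `Hᵀ H ≺ g P⁻¹`. -/
theorem posDef_smul_inv_sub_transpose_mul {m n : ℕ} (H : Matrix (Fin m) (Fin n) ℝ)
    {P : Matrix (Fin n) (Fin n) ℝ} (hP : P.PosDef) {g : ℝ} (hg : 0 < g)
    (hS : (g • (1 : Matrix (Fin m) (Fin m) ℝ) - H * P * Hᵀ).PosDef) :
    (g • P⁻¹ - Hᵀ * H).PosDef := by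
  have hQ : P⁻¹.PosDef := hP.inv
  refine .of_dotProduct_mulVec_pos ?_ fun x hx => ?_
  · refine (hQ.smul hg).1.sub ?_
    simpa using isHermitian_conjTranspose_mul_self H
  · have key : x ⬝ᵥ (g • P⁻¹ - Hᵀ * H) *ᵥ x = g * qf P⁻¹ x - H *ᵥ x ⬝ᵥ H *ᵥ x := by
      rw [sub_mulVec, dotProduct_sub, smul_mulVec, dotProduct_smul, ← mulVec_mulVec,
        dotProduct_transpose_mulVec_eq, smul_eq_mul, qf]
    rw [star_trivial, key]
    have hxpos := hQ.qf_pos hx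
    rcases eq_or_ne (H *ᵥ x) 0 with h0 | h0
    · rw [h0, zero_dotProduct, sub_zero]
      positivity
    · set w := H *ᵥ x with hw
      have h1 := hS.qf_pos h0
      have h2 := hQ.qf_nonneg (g • x + -(P *ᵥ (Hᵀ *ᵥ w)))
      rw [hQ.qf_add] at h2
      have e1 : qf (g • (1 : Matrix (Fin m) (Fin m) ℝ) - H * P * Hᵀ) w =
          g * (w ⬝ᵥ w) - Hᵀ *ᵥ w ⬝ᵥ P *ᵥ (Hᵀ *ᵥ w) := by
        rw [qf, sub_mulVec, dotProduct_sub, smul_mulVec, dotProduct_smul, one_mulVec,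
          smul_eq_mul, ← mulVec_mulVec, ← mulVec_mulVec, dotProduct_comm w (H *ᵥ (P *ᵥ _)),
          ← dotProduct_transpose_mulVec_eq H (P *ᵥ _), dotProduct_comm (P *ᵥ _)]
      have e2 : qf P⁻¹ (-(P *ᵥ (Hᵀ *ᵥ w))) = Hᵀ *ᵥ w ⬝ᵥ P *ᵥ (Hᵀ *ᵥ w) := by
        rw [qf, mulVec_neg, hP.inv_mulVec_mulVec, neg_dotProduct_neg, dotProduct_comm]
      have e3 : -(P *ᵥ (Hᵀ *ᵥ w)) ⬝ᵥ P⁻¹ *ᵥ (g • x) = -(g * (w ⬝ᵥ w)) := by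
        rw [hQ.dotProduct_mulVec_comm, mulVec_neg, hP.inv_mulVec_mulVec, dotProduct_neg,
          smul_dotProduct, dotProduct_transpose_mulVec_eq, smul_eq_mul]
      have e4 : qf P⁻¹ (g • x) = g * (g * qf P⁻¹ x) := by
        simp [qf, mulVec_smul]
      rw [e2, e3, e4] at h2
      rw [e1] at h1
      have : 0 < g * (g * qf P⁻¹ x - w ⬝ᵥ w) := by linarith
      exact pos_of_mul_pos_right this hg.le

/-- (Terminal-state maximization; footnote of Theorem 1.) If `H P Hᵀ ≺ γ² I`, then
`x ↦ |ŷ − H x|² − γ² (|x − x̆|²_{P⁻¹} + c)` attains its maximum at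
`x* = (Hᵀ H − γ² P⁻¹)⁻¹ (Hᵀ ŷ − γ² P⁻¹ x̆)`, with maximum value
`|ŷ − H x̆|²_{(I − γ⁻² H P Hᵀ)⁻¹} − γ² c`. -/
theorem terminal_state_maximization {n m : ℕ}
    (H : Matrix (Fin m) (Fin n) ℝ) (P : Matrix (Fin n) (Fin n) ℝ)
    (hP : P.PosDef) (γ : ℝ) (hγ : 0 < γ)
    (hgam : (γ ^ 2 • (1 : Matrix (Fin m) (Fin m) ℝ) - H * P * Hᵀ).PosDef)
    (yh : Fin m → ℝ) (xbr : Fin n → ℝ) (c : ℝ)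
    (xstar : Fin n → ℝ)
    (hxstar : xstar = (Hᵀ * H - γ ^ 2 • P⁻¹)⁻¹ *ᵥ
      (Hᵀ *ᵥ yh - γ ^ 2 • (P⁻¹ *ᵥ xbr))) :
    (∀ x : Fin n → ℝ,
        (yh - H *ᵥ x) ⬝ᵥ (yh - H *ᵥ x) - γ ^ 2 * (qf P⁻¹ (x - xbr) + c) ≤
          (yh - H *ᵥ xstar) ⬝ᵥ (yh - H *ᵥ xstar) - γ ^ 2 * (qf P⁻¹ (xstar - xbr) + c)) ∧
      (yh - H *ᵥ xstar) ⬝ᵥ (yh - H *ᵥ xstar) - γ ^ 2 * (qf P⁻¹ (xstar - xbr) + c) =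
        qf ((1 : Matrix (Fin m) (Fin m) ℝ) - (γ ^ 2)⁻¹ • (H * P * Hᵀ))⁻¹ (yh - H *ᵥ xbr) -
          γ ^ 2 * c := by
  have hg : 0 < γ ^ 2 := by positivity
  generalize γ ^ 2 = g at *
  have hQ : P⁻¹.PosDef := hP.inv
  have hA := posDef_smul_inv_sub_transpose_mul H hP hg hgam
  have hdet := (isUnit_iff_isUnit_det _).1 hgam.isUnit
  set S := g • (1 : Matrix (Fin m) (Fin m) ℝ) - H * P * Hᵀ with hS
  set e := yh - H *ᵥ xbr with he
  set u := S⁻¹ *ᵥ e with hu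
  set d := -(P *ᵥ (Hᵀ *ᵥ u)) with hd
  have hSu : S *ᵥ u = e := by rw [hu, mulVec_mulVec, mul_nonsing_inv _ hdet, one_mulVec]
  have hQd : P⁻¹ *ᵥ d = -(Hᵀ *ᵥ u) := by rw [hd, mulVec_neg, hP.inv_mulVec_mulVec]
  have hres : e - H *ᵥ d = g • u := by
    rw [← hSu, hS, hd, sub_mulVec, smul_mulVec, one_mulVec, mulVec_neg, ← mulVec_mulVec,
      ← mulVec_mulVec]
    abel
  have hx : xstar = xbr + d := by
    have hM : IsUnit (Hᵀ * H - g • P⁻¹).det := by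
      rw [← isUnit_iff_isUnit_det, ← neg_sub]
      exact hA.isUnit.neg
    have hstat : Hᵀ *ᵥ yh - g • (P⁻¹ *ᵥ xbr) = (Hᵀ * H - g • P⁻¹) *ᵥ (xbr + d) := by
      have hy : yh = g • u + H *ᵥ d + H *ᵥ xbr := by rw [← hres, he]; abel
      rw [sub_mulVec, smul_mulVec, mulVec_add P⁻¹, hQd, ← mulVec_mulVec, hy]
      simp only [mulVec_add, mulVec_smul, smul_add, smul_neg]
      abel
    rw [hxstar, hstat, mulVec_mulVec, nonsing_inv_mul _ hM, one_mulVec]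
  have hresx : yh - H *ᵥ xstar = g • u := by
    rw [hx, mulVec_add, ← hres, he]; abel
  have hdx : xstar - xbr = d := by rw [hx]; abel
  rw [hresx, hdx]
  refine ⟨fun x => ?_, ?_⟩
  · obtain ⟨h, rfl⟩ : ∃ h, x = xstar + h := ⟨x - xstar, by abel⟩
    have h1 : yh - H *ᵥ (xstar + h) = g • u - H *ᵥ h := by
      rw [← hresx, mulVec_add]; abel
    have h2 : xstar + h - xbr = d + h := by rw [← hdx]; abel
    have h3 := hA.qf_nonneg h
    rw [qf, sub_mulVec, dotProduct_sub, smul_mulVec, dotProduct_smul, ← mulVec_mulVec,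
      dotProduct_transpose_mulVec_eq, smul_eq_mul] at h3
    rw [h1, h2, hQ.qf_add, hQd, dotProduct_neg, dotProduct_transpose_mulVec_eq]
    simp only [sub_dotProduct, dotProduct_sub, smul_dotProduct, dotProduct_smul, smul_eq_mul,
      dotProduct_comm u (H *ᵥ h)]
    rw [qf, qf]
    linarith
  · have hinv : ((1 : Matrix (Fin m) (Fin m) ℝ) - g⁻¹ • (H * P * Hᵀ))⁻¹ = g • S⁻¹ := by
      have hfac : (1 : Matrix (Fin m) (Fin m) ℝ) - g⁻¹ • (H * P * Hᵀ) = g⁻¹ • S := by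
        rw [hS, smul_sub, smul_smul, inv_mul_cancel₀ hg.ne', one_smul]
      apply inv_eq_right_inv
      rw [hfac, smul_mul_smul_comm, mul_nonsing_inv _ hdet, inv_mul_cancel₀ hg.ne', one_smul]
    have hval : qf P⁻¹ d = u ⬝ᵥ (H *ᵥ (P *ᵥ (Hᵀ *ᵥ u))) := by
      rw [qf, hQd, dotProduct_neg, dotProduct_transpose_mulVec_eq, hd, mulVec_neg,
        neg_dotProduct, neg_neg, dotProduct_comm]
    have hue : e ⬝ᵥ u = g * (u ⬝ᵥ u) - u ⬝ᵥ (H *ᵥ (P *ᵥ (Hᵀ *ᵥ u))) := by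
      rw [dotProduct_comm, ← hSu, hS, sub_mulVec, smul_mulVec, one_mulVec, dotProduct_sub,
        dotProduct_smul, smul_eq_mul, ← mulVec_mulVec, ← mulVec_mulVec]
    rw [hinv, hval, qf, smul_mulVec, ← hu, dotProduct_smul g e u, hue]
    simp only [smul_dotProduct, dotProduct_smul, smul_eq_mul]
    ring
end

section
/- (Positive definiteness of the interpolated weight matrix.) Let A ∈ ℝ^{n×m}, let X ∈ ℝ^{n×n} and Y ∈ ℝ^{m×m} be symmetric positive definite, and let γ > 0. If Aᵀ X⁻¹ A − γ² Y⁻¹ ≺ 0, then X − γ⁻² A Y Aᵀ ≻ 0. -/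
open Matrix

open scoped ComplexOrder in
/-- If `X` and `D` are positive definite and one Schur complement of `fromBlocks X A Aᴴ D`
is positive definite, then so is the other. -/
theorem posDef_schurComplement_of_posDef_schurComplement {m n 𝕜 : Type*} [Fintype m] [Fintype n]
    [DecidableEq m] [DecidableEq n] [RCLike 𝕜] {X : Matrix n n 𝕜} {D : Matrix m m 𝕜}
    (hX : X.PosDef) (hD : D.PosDef) (A : Matrix n m 𝕜)
    (h : (D - Aᴴ * X⁻¹ * A).PosDef) : (X - A * D⁻¹ * Aᴴ).PosDef := by
  have := hX.isUnit.invertible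
  have := hD.isUnit.invertible
  have hsemi : (X - A * D⁻¹ * Aᴴ).PosSemidef :=
    (PosDef.fromBlocks₂₂ X A hD).1 ((PosDef.fromBlocks₁₁ A D hX).2 h.posSemidef)
  rw [hsemi.posDef_iff_isUnit, isUnit_iff_isUnit_det]
  have hdet : X.det * (D - Aᴴ * X⁻¹ * A).det = D.det * (X - A * D⁻¹ * Aᴴ).det := by
    rw [← invOf_eq_nonsing_inv, ← invOf_eq_nonsing_inv, ← det_fromBlocks₁₁, ← det_fromBlocks₂₂]
  refine isUnit_of_mul_isUnit_right (x := D.det) ?_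
  rw [← hdet]
  exact ((isUnit_iff_isUnit_det _).1 hX.isUnit).mul ((isUnit_iff_isUnit_det _).1 h.isUnit)

/-- (Positive definiteness of the interpolated weight matrix.) If `X ≻ 0`, `Y ≻ 0`,
`γ > 0` and `Aᵀ X⁻¹ A − γ² Y⁻¹ ≺ 0`, then `X − γ⁻² A Y Aᵀ ≻ 0`. -/
theorem interpolated_weight_posDef {n m : ℕ}
    (A : Matrix (Fin n) (Fin m) ℝ)
    (X : Matrix (Fin n) (Fin n) ℝ) (Y : Matrix (Fin m) (Fin m) ℝ)
    (hX : X.PosDef) (hY : Y.PosDef) (γ : ℝ) (hγ : 0 < γ)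
    (hconc : (γ ^ 2 • Y⁻¹ - Aᵀ * X⁻¹ * A).PosDef) :
    (X - (γ ^ 2)⁻¹ • (A * Y * Aᵀ)).PosDef := by
  have hYdet : IsUnit Y.det := (isUnit_iff_isUnit_det _).1 hY.isUnit
  have hinv : (γ ^ 2 • Y⁻¹)⁻¹ = (γ ^ 2)⁻¹ • Y := by
    refine inv_eq_right_inv ?_
    rw [smul_mul_smul_comm, mul_inv_cancel₀ (by positivity), nonsing_inv_mul _ hYdet, one_smul]
  have hD : (γ ^ 2 • Y⁻¹).PosDef := hY.inv.smul (by positivity)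
  have := posDef_schurComplement_of_posDef_schurComplement hX hD A
    (by rwa [conjTranspose_eq_transpose_of_trivial])
  rwa [hinv, conjTranspose_eq_transpose_of_trivial, Matrix.mul_smul, Matrix.smul_mul] at this
end

section
/- (Riccati update preserves positive definiteness.) Let F ∈ ℝ^{n×n}, H ∈ ℝ^{m×n}, and let Q, P ∈ ℝ^{n×n} and R ∈ ℝ^{m×m} be symmetric positive definite. Then the matrix Q + F P Fᵀ − F P Hᵀ (R + H P Hᵀ)⁻¹ H P Fᵀ is symmetric positive definite. -/
open Matrix

/-- By the Woodbury identity, the posterior covariance is the inverse of `P⁻¹ + Hᵀ R⁻¹ H`. -/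
lemma posDef_sub_mul_inv_mul {n m : Type*} [Fintype n] [DecidableEq n] [Fintype m] [DecidableEq m]
    {P : Matrix n n ℝ} {R : Matrix m m ℝ} (H : Matrix m n ℝ) (hP : P.PosDef) (hR : R.PosDef) :
    (P - P * Hᵀ * (R + H * P * Hᵀ)⁻¹ * (H * P)).PosDef := by
  have hPi : P⁻¹⁻¹ = P := nonsing_inv_nonsing_inv P ((isUnit_iff_isUnit_det P).1 hP.isUnit)
  have hRi : R⁻¹⁻¹ = R := nonsing_inv_nonsing_inv R ((isUnit_iff_isUnit_det R).1 hR.isUnit)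
  have hS : (R + H * P * Hᵀ).PosDef := by
    simpa using hR.add_posSemidef (hP.posSemidef.mul_mul_conjTranspose_same H)
  have hT : (P⁻¹ + Hᵀ * R⁻¹ * H).PosDef := by
    simpa using hP.inv.add_posSemidef (hR.inv.posSemidef.conjTranspose_mul_mul_same H)
  have key := add_mul_mul_inv_eq_sub P⁻¹ Hᵀ R⁻¹ H hP.inv.isUnit hR.inv.isUnit
    (by rw [hPi, hRi]; exact hS.isUnit)
  rw [hPi, hRi] at key
  rw [← Matrix.mul_assoc, ← key]
  exact hT.inv

/-- (Riccati update preserves positive definiteness.)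
`Q + F P Fᵀ − F P Hᵀ (R + H P Hᵀ)⁻¹ H P Fᵀ ≻ 0` for `Q, P, R ≻ 0`. -/
theorem riccati_update_posDef {n m : ℕ}
    (F : Matrix (Fin n) (Fin n) ℝ) (H : Matrix (Fin m) (Fin n) ℝ)
    (Q P : Matrix (Fin n) (Fin n) ℝ) (R : Matrix (Fin m) (Fin m) ℝ)
    (hQ : Q.PosDef) (hP : P.PosDef) (hR : R.PosDef) :
    (Q + F * P * Fᵀ - F * P * Hᵀ * (R + H * P * Hᵀ)⁻¹ * (H * P * Fᵀ)).PosDef := by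
  have h := hQ.add_posSemidef
    ((posDef_sub_mul_inv_mul H hP hR).posSemidef.mul_mul_conjTranspose_same F)
  simpa only [conjTranspose_eq_transpose_of_trivial, Matrix.mul_sub, Matrix.sub_mul,
    Matrix.mul_assoc, add_sub_assoc] using h
end

section
/- (Gain push-through identity used in the proof of Lemma 1.) Let F ∈ ℝ^{n×n}, H ∈ ℝ^{m×n}, and let Q, P ∈ ℝ^{n×n} and R ∈ ℝ^{m×m} be symmetric positive definite. Set S = Fᵀ Q⁻¹ F + Hᵀ R⁻¹ H + P⁻¹ and P⁺ = (Q⁻¹ − Q⁻¹ F S⁻¹ Fᵀ Q⁻¹)⁻¹. Then Q⁻¹ − Q⁻¹ F S⁻¹ Fᵀ Q⁻¹ is positive definite (so P⁺ is well-defined) and P⁺ Q⁻¹ F S⁻¹ = F (Hᵀ R⁻¹ H + P⁻¹)⁻¹. -/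
open Matrix

/-- (Gain push-through identity used in the proof of Lemma 1.) With
`S = Fᵀ Q⁻¹ F + Hᵀ R⁻¹ H + P⁻¹` and `P⁺ = (Q⁻¹ − Q⁻¹ F S⁻¹ Fᵀ Q⁻¹)⁻¹`,
the matrix `Q⁻¹ − Q⁻¹ F S⁻¹ Fᵀ Q⁻¹` is positive definite and
`P⁺ Q⁻¹ F S⁻¹ = F (Hᵀ R⁻¹ H + P⁻¹)⁻¹`. -/
theorem gain_push_through {n m : ℕ}
    (F : Matrix (Fin n) (Fin n) ℝ) (H : Matrix (Fin m) (Fin n) ℝ)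
    (Q P : Matrix (Fin n) (Fin n) ℝ) (R : Matrix (Fin m) (Fin m) ℝ)
    (hQ : Q.PosDef) (hP : P.PosDef) (hR : R.PosDef)
    (S : Matrix (Fin n) (Fin n) ℝ) (hS : S = Fᵀ * Q⁻¹ * F + Hᵀ * R⁻¹ * H + P⁻¹)
    (Pp : Matrix (Fin n) (Fin n) ℝ) (hPp : Pp = (Q⁻¹ - Q⁻¹ * F * S⁻¹ * (Fᵀ * Q⁻¹))⁻¹) :
    (Q⁻¹ - Q⁻¹ * F * S⁻¹ * (Fᵀ * Q⁻¹)).PosDef ∧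
      Pp * Q⁻¹ * F * S⁻¹ = F * (Hᵀ * R⁻¹ * H + P⁻¹)⁻¹ := by
  have hW : (Hᵀ * R⁻¹ * H + P⁻¹).PosDef :=
    hP.inv.posSemidef_add
      (by simpa using hR.inv.posSemidef.conjTranspose_mul_mul_same H)
  set W := Hᵀ * R⁻¹ * H + P⁻¹ with hWdef
  have hSW : S = W + Fᵀ * Q⁻¹ * F := by rw [hS, hWdef]; abel
  have hSpd : S.PosDef := by
    rw [hSW]
    exact hW.add_posSemidef
      (by simpa using hQ.inv.posSemidef.conjTranspose_mul_mul_same F)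
  have hWW : W⁻¹⁻¹ = W := nonsing_inv_nonsing_inv W ((isUnit_iff_isUnit_det W).1 hW.isUnit)
  have hWoodbury : Q⁻¹ - Q⁻¹ * F * S⁻¹ * (Fᵀ * Q⁻¹) = (Q + F * W⁻¹ * Fᵀ)⁻¹ := by
    rw [add_mul_mul_inv_eq_sub Q F W⁻¹ Fᵀ hQ.isUnit hW.inv.isUnit
      (by rw [hWW, ← hSW]; exact hSpd.isUnit), hWW, ← hSW, ← Matrix.mul_assoc]
  have hG : (Q + F * W⁻¹ * Fᵀ).PosDef :=
    hQ.add_posSemidef (by simpa using hW.inv.posSemidef.mul_mul_conjTranspose_same F)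
  refine ⟨hWoodbury ▸ hG.inv, ?_⟩
  have hQdet := (isUnit_iff_isUnit_det Q).1 hQ.isUnit
  have hWdet := (isUnit_iff_isUnit_det W).1 hW.isUnit
  have hSdet := (isUnit_iff_isUnit_det S).1 hSpd.isUnit
  have hPush : (Q + F * W⁻¹ * Fᵀ) * Q⁻¹ * F = F * W⁻¹ * S := by
    rw [hSW, Matrix.add_mul, mul_nonsing_inv Q hQdet, Matrix.add_mul, Matrix.one_mul,
      Matrix.mul_add, nonsing_inv_mul_cancel_right W F hWdet]
    simp only [Matrix.mul_assoc]
  rw [hPp, hWoodbury,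
    nonsing_inv_nonsing_inv _ ((isUnit_iff_isUnit_det _).1 hG.isUnit), hPush,
    mul_nonsing_inv_cancel_right S _ hSdet]
end

section
/- (Constant-term identity in the Kalman recursion.) Let H ∈ ℝ^{m×n}, let P ∈ ℝ^{n×n} and R ∈ ℝ^{m×m} be symmetric positive definite, and let y ∈ ℝ^m, x̆ ∈ ℝⁿ. Then |y|²_{R⁻¹} + |x̆|²_{P⁻¹} − |Hᵀ R⁻¹ y + P⁻¹ x̆|²_{(Hᵀ R⁻¹ H + P⁻¹)⁻¹} = |H x̆ − y|²_{(R + H P Hᵀ)⁻¹}. -/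
open Matrix

/-- (Constant-term identity in the Kalman recursion.)
`|y|²_{R⁻¹} + |x̆|²_{P⁻¹} − |Hᵀ R⁻¹ y + P⁻¹ x̆|²_{(Hᵀ R⁻¹ H + P⁻¹)⁻¹} = |H x̆ − y|²_{(R + H P Hᵀ)⁻¹}`. -/
theorem kalman_constant_term_identity {n m : ℕ}
    (H : Matrix (Fin m) (Fin n) ℝ)
    (P : Matrix (Fin n) (Fin n) ℝ) (R : Matrix (Fin m) (Fin m) ℝ)
    (hP : P.PosDef) (hR : R.PosDef)
    (y : Fin m → ℝ) (xbr : Fin n → ℝ) :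
    qf R⁻¹ y + qf P⁻¹ xbr -
        qf (Hᵀ * R⁻¹ * H + P⁻¹)⁻¹ (Hᵀ *ᵥ (R⁻¹ *ᵥ y) + P⁻¹ *ᵥ xbr) =
      qf (R + H * P * Hᵀ)⁻¹ (H *ᵥ xbr - y) := by
  have hRu := (isUnit_iff_isUnit_det _).mp hR.isUnit
  have hPu := (isUnit_iff_isUnit_det _).mp hP.isUnit
  have hRt : Rᵀ = R := by simpa using hR.isHermitian.eq
  have hPt : Pᵀ = P := by simpa using hP.isHermitian.eq
  have hA : (Hᵀ * R⁻¹ * H + P⁻¹).PosDef := by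
    simpa using PosDef.posSemidef_add (hR.inv.posSemidef.conjTranspose_mul_mul_same H) hP.inv
  have hS : (R + H * P * Hᵀ).PosDef := by
    simpa using hR.add_posSemidef (hP.posSemidef.mul_mul_conjTranspose_same H)
  have hAu := (isUnit_iff_isUnit_det _).mp hA.isUnit
  have hSu := (isUnit_iff_isUnit_det _).mp hS.isUnit
  obtain ⟨r, hr⟩ : ∃ r, R⁻¹ *ᵥ y = r := ⟨_, rfl⟩
  obtain ⟨p, hp⟩ : ∃ p, P⁻¹ *ᵥ xbr = p := ⟨_, rfl⟩
  obtain ⟨w, hw⟩ : ∃ w, (R + H * P * Hᵀ)⁻¹ *ᵥ (y - H *ᵥ xbr) = w := ⟨_, rfl⟩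
  -- The minimizer of `|y - H x|²_{R⁻¹} + |x - xbr|²_{P⁻¹}`, with residual `R w`.
  obtain ⟨z, hz⟩ : ∃ z, xbr + P *ᵥ (Hᵀ *ᵥ w) = z := ⟨_, rfl⟩
  have hRr : R *ᵥ r = y := by rw [← hr, mulVec_mulVec, mul_nonsing_inv _ hRu, one_mulVec]
  have hPp : P *ᵥ p = xbr := by rw [← hp, mulVec_mulVec, mul_nonsing_inv _ hPu, one_mulVec]
  have hSw : R *ᵥ w + H *ᵥ (P *ᵥ (Hᵀ *ᵥ w)) = y - H *ᵥ xbr := by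
    rw [mulVec_mulVec, mulVec_mulVec, ← add_mulVec, ← hw, mulVec_mulVec,
      mul_nonsing_inv _ hSu, one_mulVec]
  have hHz : H *ᵥ z = y - R *ᵥ w := by
    rw [← hz, mulVec_add, eq_sub_iff_add_eq, add_assoc, add_comm _ (R *ᵥ w), hSw]
    abel
  have hAz : (Hᵀ * R⁻¹ * H + P⁻¹) *ᵥ z = Hᵀ *ᵥ r + p := by
    rw [add_mulVec, ← mulVec_mulVec, ← mulVec_mulVec, hHz, mulVec_sub, hr, mulVec_mulVec,
      nonsing_inv_mul _ hRu, one_mulVec, ← hz, mulVec_add, hp, mulVec_mulVec,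
      nonsing_inv_mul _ hPu, one_mulVec, mulVec_sub]
    abel
  have hAb : (Hᵀ * R⁻¹ * H + P⁻¹)⁻¹ *ᵥ (Hᵀ *ᵥ r + p) = z := by
    rw [← hAz, mulVec_mulVec, nonsing_inv_mul _ hAu, one_mulVec]
  have hHt (u : Fin m → ℝ) (v : Fin n → ℝ) : (Hᵀ *ᵥ u) ⬝ᵥ v = u ⬝ᵥ H *ᵥ v := by
    rw [mulVec_transpose, dotProduct_mulVec]
  have hrw : r ⬝ᵥ R *ᵥ w = y ⬝ᵥ w := by
    rw [dotProduct_mulVec, ← mulVec_transpose, hRt, hRr]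
  have hpw : p ⬝ᵥ P *ᵥ (Hᵀ *ᵥ w) = (H *ᵥ xbr) ⬝ᵥ w := by
    rw [dotProduct_mulVec, ← mulVec_transpose, hPt, hPp, dotProduct_comm, hHt, dotProduct_comm]
  have hneg : (R + H * P * Hᵀ)⁻¹ *ᵥ (H *ᵥ xbr - y) = -w := by
    rw [← neg_sub, mulVec_neg, hw]
  rw [qf, qf, qf, qf, hr, hp, hAb, hneg, add_dotProduct, hHt, hHz, dotProduct_sub, hrw, ← hz,
    dotProduct_add, hpw, dotProduct_neg, sub_dotProduct, dotProduct_comm y r,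
    dotProduct_comm xbr p]
  ring
end
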